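/- Let A ∈ ℝ₊^{n×m} and let S = (S₁,…,S_n) be an n-tuple of subsets of [m] such that a_{ij} > 0 whenever j ∈ S_i. Then cl(X_S) = V*(A^S); moreover cl(X_S) contains a vector all of whose coordinates are positive if and only if A^S is strongly definite, and in that case cl(X_S) = V*(A^S) = span((A^S)*). -/

import Mathlib

open scoped NNReal Classical

namespace MaxAlg

noncomputable section

variable {n m k N : ℕ}

/-- Support of a vector in `ℝ₊ⁿ`. -/
def supp (y : Fin n → ℝ≥0) : Set (Fin n) := { i | y i ≠ 0 }

/-- The multiorder relation `u ≤_j v`. -/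
def leOrd (j : Fin n) (u v : Fin n → ℝ≥0) : Prop :=
  u j ≠ 0 ∧ v j ≠ 0 ∧ ∀ i, u i / u j ≤ v i / v j

/-- Max span of a set of vectors: all finite max combinations. -/
def maxSpan (S : Set (Fin n → ℝ≥0)) : Set (Fin n → ℝ≥0) :=
  { y | ∃ (F : Finset (Fin n → ℝ≥0)) (lam : (Fin n → ℝ≥0) → ℝ≥0),
      ↑F ⊆ S ∧ y = F.sup fun v => lam v • v }

/-- A max cone: closed under componentwise max and nonnegative scaling. -/
def IsMaxCone (V : Set (Fin n → ℝ≥0)) : Prop :=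
  (∀ u ∈ V, ∀ w ∈ V, u ⊔ w ∈ V) ∧ ∀ (c : ℝ≥0), ∀ u ∈ V, c • u ∈ V

/-- Extremal vector of a max cone. -/
def IsExtremal (V : Set (Fin n → ℝ≥0)) (v : Fin n → ℝ≥0) : Prop :=
  v ∈ V ∧ v ≠ 0 ∧ ∀ u ∈ V, ∀ w ∈ V, v = u ⊔ w → v = u ∨ v = w

/-- Minimality w.r.t. `≤_j` in a set `W`. -/
def MinimalOrd (j : Fin n) (W : Set (Fin n → ℝ≥0)) (v : Fin n → ℝ≥0) : Prop :=
  v ∈ W ∧ v j ≠ 0 ∧ ∀ u ∈ W, leOrd j u v → leOrd j v u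

/-- Max-algebraic matrix-vector product. -/
def mulVec (A : Matrix (Fin n) (Fin m) ℝ≥0) (x : Fin m → ℝ≥0) : Fin n → ℝ≥0 :=
  fun i => Finset.univ.sup fun j => A i j * x j

/-- Max-algebraic column span of a matrix. -/
def matSpan (A : Matrix (Fin n) (Fin m) ℝ≥0) : Set (Fin n → ℝ≥0) :=
  { y | ∃ x : Fin m → ℝ≥0, y = mulVec A x }

/-- Max-algebraic matrix product. -/
def mProd (A B : Matrix (Fin n) (Fin n) ℝ≥0) : Matrix (Fin n) (Fin n) ℝ≥0 :=
  fun i j => Finset.univ.sup fun t => A i t * B t j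

/-- Max-algebraic identity matrix. -/
def mId (n : ℕ) : Matrix (Fin n) (Fin n) ℝ≥0 :=
  fun i j => if i = j then 1 else 0

/-- Max-algebraic matrix power. -/
def mPow (A : Matrix (Fin n) (Fin n) ℝ≥0) : ℕ → Matrix (Fin n) (Fin n) ℝ≥0
  | 0 => mId n
  | t + 1 => mProd (mPow A t) A

/-- Maximum cycle geometric mean `λ(A)`. -/
def maxCycleMean (A : Matrix (Fin n) (Fin n) ℝ≥0) : ℝ≥0 :=
  sSup { w | ∃ (p : ℕ) (hp : 0 < p) (c : Fin p → Fin n),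
    w = (∏ t : Fin p, A (c t) (c ⟨((t : ℕ) + 1) % p, Nat.mod_lt _ hp⟩)) ^ ((1 : ℝ) / (p : ℝ)) }

/-- Kleene star `A* = I ⊕ A ⊕ ⋯ ⊕ A^{n-1}`. -/
def kleene (A : Matrix (Fin n) (Fin n) ℝ≥0) : Matrix (Fin n) (Fin n) ℝ≥0 :=
  fun i j => (Finset.range n).sup fun t => mPow A t i j

/-- Eigencone `V(A)`. -/
def eigCone (A : Matrix (Fin n) (Fin n) ℝ≥0) : Set (Fin n → ℝ≥0) :=
  { x | mulVec A x = x }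

/-- Subeigencone `V*(A)`. -/
def subEigCone (A : Matrix (Fin n) (Fin n) ℝ≥0) : Set (Fin n → ℝ≥0) :=
  { x | mulVec A x ≤ x }

/-- Kleene star predicate: multiplicatively idempotent with unit diagonal. -/
def IsKleeneStar (Q : Matrix (Fin n) (Fin n) ℝ≥0) : Prop :=
  mProd Q Q = Q ∧ ∀ i, Q i i = 1

/-- Projector onto a (closed) max cone: `P_V(y) = max{v ∈ V ∣ v ≤ y}`. -/
def proj (V : Set (Fin n → ℝ≥0)) (y : Fin n → ℝ≥0) : Fin n → ℝ≥0 :=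
  fun i => sSup ((fun v => v i) '' { v ∈ V | v ≤ y })

/-- Residuation `y / v = min_{i ∈ supp v} yᵢ/vᵢ`. -/
def resid (y v : Fin n → ℝ≥0) : ℝ≥0 :=
  sInf ((fun i => y i / v i) '' supp v)

/-- `(i,j)` is a critical edge: it lies on a cycle of geometric-mean weight 1. -/
def IsCriticalEdge (B : Matrix (Fin n) (Fin n) ℝ≥0) (i j : Fin n) : Prop :=
  ∃ (p : ℕ) (hp : 0 < p) (c : Fin p → Fin n) (t : Fin p),
    c t = i ∧ c ⟨((t : ℕ) + 1) % p, Nat.mod_lt _ hp⟩ = j ∧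
    (∏ s : Fin p, B (c s) (c ⟨((s : ℕ) + 1) % p, Nat.mod_lt _ hp⟩)) ^ ((1 : ℝ) / (p : ℝ)) = 1

/-- The matrix `A^S` associated with an `n`-tuple `S` of subsets of `[m]`. -/
def typeMat (A : Matrix (Fin n) (Fin m) ℝ≥0) (S : Fin n → Set (Fin m)) :
    Matrix (Fin n) (Fin n) ℝ≥0 :=
  fun i j =>
    if S j = ∅ then (if i = j then 1 else 0)
    else sSup ((fun t => A i t / A j t) '' S j)

/-- The closed region `cl(X_S)`. -/
def clRegion (A : Matrix (Fin n) (Fin m) ℝ≥0) (S : Fin n → Set (Fin m)) :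
    Set (Fin n → ℝ≥0) :=
  { y | ∀ t i : Fin n, ∀ j ∈ S i, A t j / A i j * y i ≤ y t }

/-- Row type of a positive vector w.r.t. a matrix. -/
def rowType (A : Matrix (Fin n) (Fin m) ℝ≥0) (y : Fin n → ℝ≥0) : Fin n → Set (Fin m) :=
  fun i => { j | ∀ t, A t j / y t ≤ A i j / y i }

/-- Max-algebraic permanent. -/
def maxPer (A : Matrix (Fin n) (Fin n) ℝ≥0) : ℝ≥0 :=
  Finset.univ.sup fun σ : Equiv.Perm (Fin n) => ∏ i, A i (σ i)

/-- Max-algebraic pseudoinverse `A^∇ = per(A)⁻¹ ⋅ A^adj`, where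
`(A^adj)_{ij} = per(A_{ji})`. -/
def pinv (A : Matrix (Fin (N + 1)) (Fin (N + 1)) ℝ≥0) :
    Matrix (Fin (N + 1)) (Fin (N + 1)) ℝ≥0 :=
  fun i j => (maxPer A)⁻¹ * maxPer (A.submatrix j.succAbove i.succAbove)

/-- Column normalization `A^{cσ}`. -/
def colNorm (A : Matrix (Fin n) (Fin n) ℝ≥0) (σ : Equiv.Perm (Fin n)) :
    Matrix (Fin n) (Fin n) ℝ≥0 :=
  fun i j => A i (σ j) / A j (σ j)

/-- Row normalization `A^{rσ}`. -/
def rowNorm (A : Matrix (Fin n) (Fin n) ℝ≥0) (σ : Equiv.Perm (Fin n)) :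
    Matrix (Fin n) (Fin n) ℝ≥0 :=
  fun i j => A (σ.symm i) j / A (σ.symm i) i

/-- The diagonal matrix `D^σ`. -/
def permDiag (A : Matrix (Fin n) (Fin n) ℝ≥0) (σ : Equiv.Perm (Fin n)) :
    Matrix (Fin n) (Fin n) ℝ≥0 :=
  fun i j => if j = σ i then A i j else 0

/-- The cyclic projector `P_k ∘ ⋯ ∘ P_1` onto the column spans of a family of matrices. -/
def cycProj {mdim : Fin k → ℕ} (A : (s : Fin k) → Matrix (Fin n) (Fin (mdim s)) ℝ≥0) :
    (Fin n → ℝ≥0) → Fin n → ℝ≥0 :=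
  fun y => (List.ofFn fun s => proj (matSpan (A s))).foldl (fun z f => f z) y

/-- The max-algebraic product `A^(1) ⊗ ⋯ ⊗ A^(k)` of a family of matrices. -/
def prodAll (A : Fin k → Matrix (Fin n) (Fin n) ℝ≥0) : Matrix (Fin n) (Fin n) ℝ≥0 :=
  (List.ofFn A).foldr mProd (mId n)

/-- The sequence of products `C^(m) = A^{(j(m))} ⊗ ⋯ ⊗ A^{(j(1))}`. -/
def prodSeq (A : Fin k → Matrix (Fin n) (Fin n) ℝ≥0) (j : ℕ → Fin k) :
    ℕ → Matrix (Fin n) (Fin n) ℝ≥0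
  | 0 => mId n
  | t + 1 => mProd (A (j (t + 1))) (prodSeq A j t)

/-- Hilbert projective distance, valued in the extended reals. -/
def rhoH (y1 y2 : Fin n → ℝ≥0) : EReal :=
  if supp y1 = supp y2 then
    ((Real.log ((sSup { t : ℝ≥0 | ∃ i ∈ supp y1, ∃ j ∈ supp y1,
        t = y1 i / y2 i * (y2 j / y1 j) } : ℝ≥0) : ℝ)) : EReal)
  else ⊤

/-- Max-plus (additive) matrix-vector product over `ℝ`. -/
def mpMulVec (A : Matrix (Fin n) (Fin m) ℝ) (x : Fin m → ℝ) : Fin n → ℝ :=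
  fun i => ⨆ j, (A i j + x j)

/-- Min-plus residuated product `Ā ⊗' y` over `ℝ`. -/
def mpDual (A : Matrix (Fin n) (Fin m) ℝ) (y : Fin n → ℝ) : Fin m → ℝ :=
  fun j => ⨅ i, (y i - A i j)

/-- Max-plus projector onto the column span of `A`: `P_A(y) = A ⊗ (Ā ⊗' y)`. -/
def mpProj (A : Matrix (Fin n) (Fin m) ℝ) (y : Fin n → ℝ) : Fin n → ℝ :=
  mpMulVec A (mpDual A y)

/-- Range seminorm `‖A‖ = max_{i,j,l}(a_{il} − a_{jl})`. -/
def mpNorm (A : Matrix (Fin n) (Fin m) ℝ) : ℝ :=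
  ⨆ i, ⨆ j, ⨆ l, (A i l - A j l)

/-- One sweep `P_k ∘ ⋯ ∘ P_1` of the max-plus alternating method. -/
def altStep {mdim : Fin k → ℕ} (A : (s : Fin k) → Matrix (Fin n) (Fin (mdim s)) ℝ) :
    (Fin n → ℝ) → Fin n → ℝ :=
  fun y => (List.ofFn fun s => mpProj (A s)).foldl (fun z f => f z) y

end

theorem mem_subEigCone_iff {n : ℕ} {B : Matrix (Fin n) (Fin n) ℝ≥0} {x : Fin n → ℝ≥0} :
    x ∈ subEigCone B ↔ ∀ i j, B i j * x j ≤ x i := by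
  simp [subEigCone, mulVec, Pi.le_def]

theorem clRegion_eq_subEigCone {n m : ℕ} (A : Matrix (Fin n) (Fin m) ℝ≥0)
    (S : Fin n → Set (Fin m)) : clRegion A S = subEigCone (typeMat A S) := by
  ext y
  rw [mem_subEigCone_iff]
  constructor
  · intro hy i j
    by_cases hj : S j = ∅
    · rcases eq_or_ne i j with rfl | hij
      · simp [typeMat, hj]
      · simp [typeMat, hj, hij]
    · obtain ⟨t, ht, hval⟩ := (((S j).nonempty_iff_ne_empty.mpr hj).image
        fun t => A i t / A j t).csSup_mem (Set.toFinite _)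
      simp only [typeMat, hj, if_false]
      rw [← hval]
      exact hy i j t ht
  · intro hy t i j hj
    have hne : S i ≠ ∅ := Set.Nonempty.ne_empty ⟨j, hj⟩
    refine le_trans (mul_le_mul_left ?_ _) (hy t i)
    simp only [typeMat, hne, if_false]
    exact le_csSup (Set.toFinite _).bddAbove ⟨j, hj, rfl⟩

theorem typeMat_self {n m : ℕ} (A : Matrix (Fin n) (Fin m) ℝ≥0)
    (S : Fin n → Set (Fin m)) (hS : ∀ i, ∀ j ∈ S i, 0 < A i j) (i : Fin n) :
    typeMat A S i i = 1 := by
  by_cases hi : S i = ∅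
  · simp [typeMat, hi]
  · obtain ⟨t, ht, hval⟩ := (((S i).nonempty_iff_ne_empty.mpr hi).image
      fun t => A i t / A i t).csSup_mem (Set.toFinite _)
    simp only [typeMat, hi, if_false]
    rw [← hval]
    exact div_self (hS i t ht).ne'

/-- Every cycle of `B` has weight at most `1`. -/
def CyclesLeOne {n : ℕ} (B : Matrix (Fin n) (Fin n) ℝ≥0) : Prop :=
  ∀ (p : ℕ) (hp : 0 < p) (c : Fin p → Fin n),
    ∏ t : Fin p, B (c t) (c ⟨((t : ℕ) + 1) % p, Nat.mod_lt _ hp⟩) ≤ 1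

theorem bijective_cyclicSucc {p : ℕ} (hp : 0 < p) :
    Function.Bijective fun t : Fin p => (⟨((t : ℕ) + 1) % p, Nat.mod_lt _ hp⟩ : Fin p) := by
  rw [← Finite.injective_iff_bijective]
  intro a b hab
  have hmod : ((a : ℕ) + 1) % p = ((b : ℕ) + 1) % p := congrArg Fin.val hab
  have h : (a : ℕ) % p = (b : ℕ) % p := Nat.ModEq.add_right_cancel' 1 hmod
  rw [Nat.mod_eq_of_lt a.2, Nat.mod_eq_of_lt b.2] at h
  exact Fin.ext h

theorem cyclesLeOne_of_pos_mem_subEigCone {n : ℕ} {B : Matrix (Fin n) (Fin n) ℝ≥0}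
    {y : Fin n → ℝ≥0} (hy : y ∈ subEigCone B) (hpos : ∀ i, 0 < y i) : CyclesLeOne B := by
  intro p hp c
  have hshift := (bijective_cyclicSucc hp).prod_comp fun t => y (c t)
  have hle : ∏ t : Fin p, (B (c t) (c ⟨((t : ℕ) + 1) % p, Nat.mod_lt _ hp⟩) *
      y (c ⟨((t : ℕ) + 1) % p, Nat.mod_lt _ hp⟩)) ≤ ∏ t : Fin p, y (c t) :=
    Finset.prod_le_prod' fun t _ => mem_subEigCone_iff.mp hy _ _
  rw [Finset.prod_mul_distrib, hshift] at hle
  exact le_of_mul_le_mul_right (by rwa [one_mul]) (Finset.prod_pos fun t _ => hpos (c t))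

theorem cyclesLeOne_of_maxCycleMean_eq_one {n : ℕ} {B : Matrix (Fin n) (Fin n) ℝ≥0}
    (h : maxCycleMean B = 1) : CyclesLeOne B := by
  intro p hp c
  unfold maxCycleMean at h
  set W := { w : ℝ≥0 | ∃ (p : ℕ) (hp : 0 < p) (c : Fin p → Fin n),
    w = (∏ t : Fin p, B (c t) (c ⟨((t : ℕ) + 1) % p, Nat.mod_lt _ hp⟩)) ^ ((1 : ℝ) / (p : ℝ)) }
  have hbdd : BddAbove W := by
    by_contra hW
    rw [NNReal.sSup_of_not_bddAbove hW] at h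
    exact zero_ne_one h
  have hle := (le_csSup hbdd ⟨p, hp, c, rfl⟩).trans h.le
  exact le_of_not_gt fun hgt => hle.not_gt (NNReal.one_lt_rpow hgt (by positivity))

theorem maxCycleMean_eq_one {n : ℕ} (hn : 0 < n) {B : Matrix (Fin n) (Fin n) ℝ≥0}
    (hB : CyclesLeOne B) (hdiag : ∀ i, B i i = 1) : maxCycleMean B = 1 := by
  refine IsGreatest.csSup_eq ⟨⟨1, one_pos, fun _ => ⟨0, hn⟩, by simp [hdiag]⟩, ?_⟩
  rintro w ⟨p, hp, c, rfl⟩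
  exact NNReal.rpow_le_one (hB p hp c) (by positivity)

/-- Weight of the first `t` steps of the walk `w` in the weighted digraph of `B`. -/
noncomputable def walkWeight {n : ℕ} (B : Matrix (Fin n) (Fin n) ℝ≥0) (w : ℕ → Fin n)
    (t : ℕ) : ℝ≥0 :=
  ∏ s ∈ Finset.range t, B (w s) (w (s + 1))

theorem walkWeight_add {n : ℕ} (B : Matrix (Fin n) (Fin n) ℝ≥0) (w : ℕ → Fin n) (a b : ℕ) :
    walkWeight B w (a + b) = walkWeight B w a * walkWeight B (fun s => w (a + s)) b :=
  Finset.prod_range_add _ _ _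

theorem walkWeight_congr {n : ℕ} (B : Matrix (Fin n) (Fin n) ℝ≥0) {w v : ℕ → Fin n} {t : ℕ}
    (h : ∀ s ≤ t, w s = v s) : walkWeight B w t = walkWeight B v t := by
  refine Finset.prod_congr rfl fun s hs => ?_
  rw [Finset.mem_range] at hs
  rw [h s hs.le, h (s + 1) hs]

theorem walkWeight_le_one_of_closed {n : ℕ} {B : Matrix (Fin n) (Fin n) ℝ≥0}
    (hB : CyclesLeOne B) {w : ℕ → Fin n} {p : ℕ} (hp : 0 < p) (hw : w p = w 0) :
    walkWeight B w p ≤ 1 := by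
  refine le_trans (le_of_eq ?_) (hB p hp fun t => w t)
  rw [walkWeight, Finset.prod_range]
  refine Finset.prod_congr rfl fun t _ => ?_
  rcases (Nat.succ_le_of_lt t.2).lt_or_eq with ht | ht
  · simp only [Nat.mod_eq_of_lt ht]
  · simp only [Nat.succ_eq_add_one] at ht
    simp only [ht, Nat.mod_self, hw]

theorem walkWeight_le_mPow {n : ℕ} (B : Matrix (Fin n) (Fin n) ℝ≥0) (w : ℕ → Fin n) (t : ℕ) :
    walkWeight B w t ≤ mPow B t (w 0) (w t) := by
  induction t with
  | zero => simp [walkWeight, mPow, mId]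
  | succ t ih =>
    rw [walkWeight, Finset.prod_range_succ]
    exact (mul_le_mul_left ih _).trans (Finset.le_sup
      (f := fun k => mPow B t (w 0) k * B k (w (t + 1))) (Finset.mem_univ (w t)))

theorem mPow_eq_zero_or_exists_walk {n : ℕ} (B : Matrix (Fin n) (Fin n) ℝ≥0) (t : ℕ)
    (i j : Fin n) : mPow B t i j = 0 ∨
      ∃ w : ℕ → Fin n, w 0 = i ∧ w t = j ∧ mPow B t i j = walkWeight B w t := by
  induction t generalizing j with
  | zero =>
    rcases eq_or_ne i j with rfl | hij
    · exact Or.inr ⟨fun _ => i, rfl, rfl, by simp [walkWeight, mPow, mId]⟩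
    · exact Or.inl (by simp [mPow, mId, hij])
  | succ t ih =>
    obtain ⟨k, -, hk⟩ := Finset.exists_mem_eq_sup Finset.univ ⟨i, Finset.mem_univ i⟩
      fun k => mPow B t i k * B k j
    change mPow B (t + 1) i j = _ at hk
    rcases ih k with h0 | ⟨w, hw0, hwt, hw⟩
    · exact Or.inl (by rw [hk, h0, zero_mul])
    · refine Or.inr ⟨Function.update w (t + 1) j, by simp [hw0], by simp, ?_⟩
      have hcongr : walkWeight B (Function.update w (t + 1) j) t = walkWeight B w t :=
        walkWeight_congr B fun s hs => Function.update_of_ne (by lia) _ _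
      rw [hk, hw, ← hcongr, walkWeight, walkWeight, Finset.prod_range_succ]
      simp [hwt]

theorem mPow_le_kleene {n : ℕ} (B : Matrix (Fin n) (Fin n) ℝ≥0) {t : ℕ} (ht : t < n)
    (i j : Fin n) : mPow B t i j ≤ kleene B i j :=
  Finset.le_sup (f := fun t => mPow B t i j) (Finset.mem_range.mpr ht)

/-- Removing closed subwalks does not decrease the weight when all cycles have weight at
most `1`, so every walk weight is bounded by the Kleene star. -/
theorem walkWeight_le_kleene {n : ℕ} {B : Matrix (Fin n) (Fin n) ℝ≥0} (hB : CyclesLeOne B)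
    (w : ℕ → Fin n) (t : ℕ) : walkWeight B w t ≤ kleene B (w 0) (w t) := by
  induction t using Nat.strong_induction_on generalizing w with
  | _ t ih =>
    rcases lt_or_ge t n with ht | ht
    · exact (walkWeight_le_mPow B w t).trans (mPow_le_kleene B ht _ _)
    · obtain ⟨a, b, hab, hbt, hwab⟩ : ∃ a b, a < b ∧ b ≤ t ∧ w a = w b := by
        obtain ⟨a, b, hne, heq⟩ := Fintype.exists_ne_map_eq_of_card_lt
          (fun s : Fin (t + 1) => w s) (by simpa using Nat.lt_succ_of_le ht)
        rcases lt_or_gt_of_ne hne with h | h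
        · exact ⟨a, b, h, Nat.le_of_lt_succ b.2, heq⟩
        · exact ⟨b, a, h, Nat.le_of_lt_succ a.2, heq.symm⟩
      obtain ⟨p, rfl⟩ := Nat.exists_eq_add_of_lt hab
      obtain ⟨q, rfl⟩ := Nat.exists_eq_add_of_le hbt
      let v : ℕ → Fin n := fun s => if s ≤ a then w s else w (s + (p + 1))
      have hv : ∀ s, v (a + s) = w (a + p + 1 + s) := by
        intro s
        rcases Nat.eq_zero_or_pos s with rfl | hs
        · simpa [v] using hwab
        · simp only [v, show ¬ a + s ≤ a by lia, if_false]
          congr 1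
          lia
      have hv0 : v 0 = w 0 := by simp [v]
      have hva : walkWeight B v a = walkWeight B w a :=
        walkWeight_congr B fun s hs => if_pos hs
      have hcycle : walkWeight B (fun s => w (a + s)) (p + 1) ≤ 1 :=
        walkWeight_le_one_of_closed hB p.succ_pos hwab.symm
      have hle := ih (a + q) (by lia) v
      rw [walkWeight_add, hva, funext hv, hv, hv0] at hle
      rw [walkWeight_add, add_assoc a p 1, walkWeight_add]
      refine le_trans (mul_le_mul_left (mul_le_of_le_one_right' hcycle) _) ?_
      simpa only [add_assoc] using hle

theorem mPow_le_kleene_of_cyclesLeOne {n : ℕ} {B : Matrix (Fin n) (Fin n) ℝ≥0}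
    (hB : CyclesLeOne B) (t : ℕ) (i j : Fin n) : mPow B t i j ≤ kleene B i j := by
  rcases mPow_eq_zero_or_exists_walk B t i j with h | ⟨w, rfl, rfl, h⟩
  · rw [h]
    exact zero_le
  · rw [h]
    exact walkWeight_le_kleene hB w t

theorem mul_mPow_le_mPow_succ {n : ℕ} (B : Matrix (Fin n) (Fin n) ℝ≥0) (t : ℕ)
    (i k j : Fin n) : B i k * mPow B t k j ≤ mPow B (t + 1) i j := by
  induction t generalizing j with
  | zero =>
    rcases eq_or_ne k j with rfl | hkj
    · refine le_trans (le_of_eq ?_) (Finset.le_sup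
        (f := fun l => mPow B 0 i l * B l k) (Finset.mem_univ i))
      simp [mPow, mId]
    · simp [mPow, mId, hkj]
  | succ t ih =>
    change B i k * Finset.univ.sup (fun l => mPow B t k l * B l j) ≤ _
    rw [NNReal.mul_finset_sup]
    refine Finset.sup_le fun l _ => ?_
    rw [← mul_assoc]
    exact (mul_le_mul_left (ih l) _).trans (Finset.le_sup
      (f := fun l => mPow B (t + 1) i l * B l j) (Finset.mem_univ l))

theorem one_le_kleene_self {n : ℕ} (B : Matrix (Fin n) (Fin n) ℝ≥0) (i : Fin n) :
    1 ≤ kleene B i i := by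
  simpa [mPow, mId] using mPow_le_kleene B i.pos i i

theorem matSpan_kleene_subset_subEigCone {n : ℕ} {B : Matrix (Fin n) (Fin n) ℝ≥0}
    (hB : CyclesLeOne B) : matSpan (kleene B) ⊆ subEigCone B := by
  rintro _ ⟨x, rfl⟩
  rw [mem_subEigCone_iff]
  intro i k
  simp only [mulVec]
  rw [NNReal.mul_finset_sup]
  refine Finset.sup_le fun j _ => ?_
  refine le_trans ?_ (Finset.le_sup (f := fun j => kleene B i j * x j) (Finset.mem_univ j))
  rw [← mul_assoc]
  refine mul_le_mul_left ?_ _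
  rw [kleene, NNReal.mul_finset_sup]
  exact Finset.sup_le fun t _ =>
    (mul_mPow_le_mPow_succ B t i k j).trans (mPow_le_kleene_of_cyclesLeOne hB _ _ _)

theorem mPow_mul_le_of_mem_subEigCone {n : ℕ} {B : Matrix (Fin n) (Fin n) ℝ≥0}
    {x : Fin n → ℝ≥0} (hx : x ∈ subEigCone B) (t : ℕ) (i j : Fin n) :
    mPow B t i j * x j ≤ x i := by
  induction t generalizing j with
  | zero =>
    rcases eq_or_ne i j with rfl | hij
    · simp [mPow, mId]
    · simp [mPow, mId, hij]
  | succ t ih =>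
    change Finset.univ.sup (fun l => mPow B t i l * B l j) * x j ≤ _
    rw [NNReal.finset_sup_mul]
    refine Finset.sup_le fun l _ => ?_
    rw [mul_assoc]
    exact (mul_le_mul_right (mem_subEigCone_iff.mp hx l j) _).trans (ih l)

theorem subEigCone_subset_matSpan_kleene {n : ℕ} (B : Matrix (Fin n) (Fin n) ℝ≥0) :
    subEigCone B ⊆ matSpan (kleene B) := by
  intro x hx
  refine ⟨x, funext fun i => le_antisymm ?_ (Finset.sup_le fun j _ => ?_)⟩
  · exact (le_mul_of_one_le_left' (one_le_kleene_self B i)).trans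
      (Finset.le_sup (f := fun j => kleene B i j * x j) (Finset.mem_univ i))
  · rw [kleene, NNReal.finset_sup_mul]
    exact Finset.sup_le fun t _ => mPow_mul_le_of_mem_subEigCone hx t i j

theorem exists_pos_mem_subEigCone {n : ℕ} {B : Matrix (Fin n) (Fin n) ℝ≥0}
    (hB : CyclesLeOne B) : ∃ y ∈ subEigCone B, ∀ i, 0 < y i := by
  refine ⟨mulVec (kleene B) 1, matSpan_kleene_subset_subEigCone hB ⟨1, rfl⟩, fun i => ?_⟩
  refine lt_of_lt_of_le (one_pos.trans_le (one_le_kleene_self B i)) ?_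
  simpa [mulVec] using Finset.le_sup (f := fun j => kleene B i j * (1 : Fin n → ℝ≥0) j)
    (Finset.mem_univ i)

/-- `cl(X_S) = V*(A^S)`, it contains a positive vector iff `A^S` is
strongly definite, in which case `cl(X_S) = span((A^S)*)`. -/
theorem stmt9 {n m : ℕ} (hn : 0 < n) (A : Matrix (Fin n) (Fin m) ℝ≥0)
    (S : Fin n → Set (Fin m)) (hS : ∀ i, ∀ j ∈ S i, 0 < A i j) :
    clRegion A S = subEigCone (typeMat A S) ∧
    ((∃ y ∈ clRegion A S, ∀ i, 0 < y i) ↔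
      (maxCycleMean (typeMat A S) = 1 ∧ ∀ i, typeMat A S i i = 1)) ∧
    ((∃ y ∈ clRegion A S, ∀ i, 0 < y i) →
      clRegion A S = matSpan (kleene (typeMat A S))) := by
  rw [clRegion_eq_subEigCone]
  refine ⟨rfl, ⟨?_, ?_⟩, ?_⟩
  · rintro ⟨y, hy, hpos⟩
    have hdiag := typeMat_self A S hS
    exact ⟨maxCycleMean_eq_one hn (cyclesLeOne_of_pos_mem_subEigCone hy hpos) hdiag, hdiag⟩
  · rintro ⟨hmean, -⟩
    exact exists_pos_mem_subEigCone (cyclesLeOne_of_maxCycleMean_eq_one hmean)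
  · rintro ⟨y, hy, hpos⟩
    exact (subEigCone_subset_matSpan_kleene _).antisymm
      (matSpan_kleene_subset_subEigCone (cyclesLeOne_of_pos_mem_subEigCone hy hpos))

end MaxAlg
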